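/- Let α ∈ ℝ^d, let a, a', h : ℝ^d → ℝ be C^∞, ℤ^d-periodic functions, and let k ∈ ℤ^d. Suppose that for all x ∈ ℝ^d, e(a'(x)) = e(k·(x+α) + h(x+α)) · e(a(x)) · e(k·x + h(x))⁻¹, i.e. the cocycle (α, e(a(·))) is conjugated to (α, e(a'(·))) by the map x ↦ e(k·x + h(x)). Then ∫_{[0,1]^d} a' − ∫_{[0,1]^d} a − k·α ∈ ℤ. In particular, the fibered rotation number ∫ a is invariant under conjugations admitting a lift to ℝ (k = 0), and in general is well defined only modulo α·ℤ^d + ℤ. -/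

import Mathlib

open MeasureTheory

/-- Dot product of an integer vector with a real vector. -/
noncomputable def dotZ {d : ℕ} (k : Fin d → ℤ) (α : Fin d → ℝ) : ℝ :=
  ∑ i, (k i : ℝ) * α i

/-- `e(t) = exp(2πit)`. -/
noncomputable def e2pi (t : ℝ) : ℂ := Complex.exp (2 * Real.pi * Complex.I * t)

/-- The integral of a `ℤ^d`-periodic function over the unit cube is translation invariant. -/
theorem setIntegral_Icc_comp_add_right_of_periodic {d : ℕ} {f : (Fin d → ℝ) → ℝ}
    (hf : ∀ (x : Fin d → ℝ) (k : Fin d → ℤ), f (x + fun i => (k i : ℝ)) = f x)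
    (α : Fin d → ℝ) :
    ∫ x in Set.Icc (0 : Fin d → ℝ) 1, f (x + α) = ∫ x in Set.Icc (0 : Fin d → ℝ) 1, f x := by
  let b := Pi.basisFun ℝ (Fin d)
  let D := ZSpan.fundamentalDomain b
  have hD : (D : Set (Fin d → ℝ)) =ᵐ[volume] Set.Icc 0 1 := by
    change ZSpan.fundamentalDomain b =ᵐ[volume] _
    rw [ZSpan.fundamentalDomain_pi_basisFun]
    exact Measure.univ_pi_Ico_ae_eq_Icc
  have hfund : IsAddFundamentalDomain (Submodule.span ℤ (Set.range b)).toAddSubgroup D volume :=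
    ZSpan.isAddFundamentalDomain' b volume
  have hinv : ∀ (g : (Submodule.span ℤ (Set.range b)).toAddSubgroup) (x : Fin d → ℝ),
      f (g +ᵥ x) = f x := by
    rintro ⟨g, hg⟩ x
    have hg' := (b.mem_span_iff_repr_mem ℤ g).mp hg
    choose k hk using hg'
    have hgk : g = fun i => (k i : ℝ) := by
      ext i
      simpa [b] using (hk i).symm
    change f (g + x) = f x
    rw [add_comm, hgk, hf]
  have : Countable (Submodule.span ℤ (Set.range b)).toAddSubgroup :=
    inferInstanceAs (Countable (Submodule.span ℤ (Set.range b)))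
  rw [← setIntegral_congr_set hD, ← setIntegral_congr_set hD,
    hfund.setIntegral_eq (hfund.vadd_of_comm α) hinv, ← Set.image_vadd,
    (measurePreserving_vadd α volume).setIntegral_image_emb (measurableEmbedding_const_vadd α)]
  simp only [vadd_eq_add, add_comm]

/-- A continuous integer-valued real function on a preconnected space is constant. -/
theorem exists_int_forall_eq_of_continuous {X : Type*} [TopologicalSpace X] [PreconnectedSpace X]
    [Nonempty X] {g : X → ℝ} (hg : Continuous g) (hint : ∀ x, ∃ n : ℤ, g x = n) :
    ∃ m : ℤ, ∀ x, g x = m := by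
  choose n hn using hint
  have hcont : Continuous n := by
    rw [Int.isClosedEmbedding_coe_real.isInducing.continuous_iff]
    exact hg.congr hn
  obtain ⟨x₀⟩ := ‹Nonempty X›
  exact ⟨n x₀, fun x => by rw [hn, PreconnectedSpace.constant ‹_› hcont (x := x) (y := x₀)]⟩

theorem e2pi_ne_zero (t : ℝ) : e2pi t ≠ 0 := Complex.exp_ne_zero _

theorem e2pi_add (s t : ℝ) : e2pi (s + t) = e2pi s * e2pi t := by
  simp only [e2pi, ← Complex.exp_add]
  push_cast
  ring_nf

theorem e2pi_eq_e2pi_iff {s t : ℝ} : e2pi s = e2pi t ↔ ∃ n : ℤ, s = t + n := by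
  rw [e2pi, e2pi, Complex.exp_eq_exp_iff_exists_int]
  refine exists_congr fun n => ?_
  have hne := Complex.two_pi_I_ne_zero
  rw [show 2 * (Real.pi : ℂ) * Complex.I * t + n * (2 * Real.pi * Complex.I) =
    2 * Real.pi * Complex.I * (t + n) by ring, mul_right_inj' hne]
  exact_mod_cast Iff.rfl

theorem dotZ_add {d : ℕ} (k : Fin d → ℤ) (x y : Fin d → ℝ) :
    dotZ k (x + y) = dotZ k x + dotZ k y := by
  simp [dotZ, mul_add, Finset.sum_add_distrib]

/-- If the cocycle `(α, e(a(·)))` is conjugated to `(α, e(a'(·)))` by the circle-valued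
map `x ↦ e(k·x + h(x))` of degree `k ∈ ℤ^d`, then
`∫ a' - ∫ a - k·α ∈ ℤ`: the fibered rotation number is invariant under conjugations
admitting a real lift (`k = 0`) and in general well defined modulo `α·ℤ^d + ℤ`. -/
theorem stmt12 (d : ℕ) (α : Fin d → ℝ) (a a' h : (Fin d → ℝ) → ℝ)
    (ha : ContDiff ℝ (⊤ : ℕ∞) a) (ha' : ContDiff ℝ (⊤ : ℕ∞) a')
    (hh : ContDiff ℝ (⊤ : ℕ∞) h)
    (hpa : ∀ (x : Fin d → ℝ) (k : Fin d → ℤ), a (x + fun i => (k i : ℝ)) = a x)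
    (hpa' : ∀ (x : Fin d → ℝ) (k : Fin d → ℤ), a' (x + fun i => (k i : ℝ)) = a' x)
    (hph : ∀ (x : Fin d → ℝ) (k : Fin d → ℤ), h (x + fun i => (k i : ℝ)) = h x)
    (k : Fin d → ℤ)
    (hconj : ∀ x : Fin d → ℝ,
      e2pi (a' x) =
        e2pi (dotZ k (x + α) + h (x + α)) * e2pi (a x) * (e2pi (dotZ k x + h x))⁻¹) :
    ∃ m : ℤ,
      (∫ x in Set.Icc (0 : Fin d → ℝ) 1, a' x) -
        (∫ x in Set.Icc (0 : Fin d → ℝ) 1, a x) - dotZ k α = (m : ℝ) := by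
  have hlift : ∀ x, ∃ n : ℤ, a' x - a x - dotZ k α - (h (x + α) - h x) = n := by
    intro x
    have hx := hconj x
    rw [eq_mul_inv_iff_mul_eq₀ (e2pi_ne_zero _), ← e2pi_add, ← e2pi_add, e2pi_eq_e2pi_iff] at hx
    obtain ⟨n, hn⟩ := hx
    rw [dotZ_add] at hn
    exact ⟨n, by linarith⟩
  have hca := ha.continuous
  have hca' := ha'.continuous
  have hch := hh.continuous
  have hchα : Continuous fun x => h (x + α) := by fun_prop
  obtain ⟨m, hm⟩ := exists_int_forall_eq_of_continuous (by fun_prop) hlift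
  refine ⟨m, ?_⟩
  have hint : ∀ {f : (Fin d → ℝ) → ℝ}, Continuous f → IntegrableOn f (Set.Icc 0 1) :=
    fun hf => hf.continuousOn.integrableOn_compact isCompact_Icc
  have hvol : volume.real (Set.Icc (0 : Fin d → ℝ) 1) = 1 := by
    simp [Measure.real, Real.volume_Icc_pi]
  have key : ∫ x in Set.Icc (0 : Fin d → ℝ) 1, (a' x - a x - (h (x + α) - h x)) =
      dotZ k α + m := by
    rw [setIntegral_congr_fun (g := fun _ => dotZ k α + m) measurableSet_Icc
      (fun x _ => by linarith [hm x]), setIntegral_const, hvol, one_smul]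
  rw [integral_sub (f := fun x => a' x - a x) (g := fun x => h (x + α) - h x)
      (hint (hca'.sub hca)) (hint (hchα.sub hch)),
    integral_sub (hint hca') (hint hca), integral_sub (hint hchα) (hint hch),
    setIntegral_Icc_comp_add_right_of_periodic hph] at key
  linarith
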